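/- If A, B : Matrix n n ℝ≥0 commute under the max-product and B is irreducible, then A has a unique eigenvalue: whenever A ⊗ v = α • v with v ≠ 0 and A ⊗ w = β • w with w ≠ 0, one has α = β. -/

import Mathlib

open scoped NNReal

/-- Max-algebraic product of matrices over ℝ≥0. -/
noncomputable def maxMul {l m p : Type*} [Fintype m]
    (A : Matrix l m ℝ≥0) (B : Matrix m p ℝ≥0) : Matrix l p ℝ≥0 :=
  fun i k => ⨆ j, A i j * B j k

/-- Max-algebraic action of a matrix on a vector over ℝ≥0. -/
noncomputable def maxVec {l m : Type*} [Fintype m]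
    (A : Matrix l m ℝ≥0) (v : m → ℝ≥0) : l → ℝ≥0 :=
  fun i => ⨆ j, A i j * v j

/-- A matrix over ℝ≥0 is irreducible if its positivity digraph is strongly connected. -/
def MaxIrreducible {n : Type*} (A : Matrix n n ℝ≥0) : Prop :=
  ∀ i j : n, i ≠ j → Relation.TransGen (fun a b => 0 < A a b) i j

lemma iSup_le_iff_of_finite {ι : Type*} [Finite ι] (f : ι → ℝ≥0) (c : ℝ≥0) :
    ⨆ i, f i ≤ c ↔ ∀ i, f i ≤ c :=
  ciSup_le_iff' (Set.finite_range f).bddAbove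

lemma le_maxVec {l m : Type*} [Fintype m] (A : Matrix l m ℝ≥0) (v : m → ℝ≥0) (i : l) (j : m) :
    A i j * v j ≤ maxVec A v i :=
  (iSup_le_iff_of_finite (fun j => A i j * v j) _).1 le_rfl j

lemma maxVec_maxVec {l m p : Type*} [Fintype m] [Fintype p]
    (A : Matrix l m ℝ≥0) (B : Matrix m p ℝ≥0) (v : p → ℝ≥0) :
    maxVec A (maxVec B v) = maxVec (maxMul A B) v := by
  funext i
  refine eq_of_forall_ge_iff fun c => ?_
  simp only [maxVec, maxMul, NNReal.mul_iSup, NNReal.iSup_mul, iSup_le_iff_of_finite, mul_assoc]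
  exact forall_comm

lemma maxVec_smul {l m : Type*} [Fintype m] (A : Matrix l m ℝ≥0) (c : ℝ≥0) (v : m → ℝ≥0) :
    maxVec A (c • v) = c • maxVec A v := by
  funext i
  simp only [maxVec, Pi.smul_apply, smul_eq_mul, NNReal.mul_iSup, mul_left_comm]

lemma smul_maxVec {l m : Type*} [Fintype m] (c : ℝ≥0) (A : Matrix l m ℝ≥0) (v : m → ℝ≥0) :
    maxVec (c • A) v = c • maxVec A v := by
  funext i
  simp only [maxVec, Matrix.smul_apply, Pi.smul_apply, smul_eq_mul, NNReal.mul_iSup, mul_assoc]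

/-- A matrix commuting with `A` preserves the eigenspaces of `A`. -/
lemma maxVec_eigenvector_of_commute {n : Type*} [Fintype n] {A B : Matrix n n ℝ≥0}
    (hcomm : maxMul A B = maxMul B A) {α : ℝ≥0} {v : n → ℝ≥0} (hv : maxVec A v = α • v) :
    maxVec A (maxVec B v) = α • maxVec B v := by
  rw [maxVec_maxVec, hcomm, ← maxVec_maxVec, hv, maxVec_smul]

/-- If `A` commutes with an irreducible matrix, every eigenvalue of `A` has an eigenvector with
full support. -/
lemma exists_pos_eigenvector {n : Type*} [Fintype n] {A B : Matrix n n ℝ≥0}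
    (hcomm : maxMul A B = maxMul B A) (hB : MaxIrreducible B) {α : ℝ≥0} {v : n → ℝ≥0}
    (hv : v ≠ 0) (hv' : maxVec A v = α • v) :
    ∃ u : n → ℝ≥0, (∀ i, 0 < u i) ∧ maxVec A u = α • u := by
  obtain ⟨j, hj⟩ := Function.ne_iff.1 hv
  have step : ∀ a b, 0 < B a b → (∃ u, 0 < u b ∧ maxVec A u = α • u) →
      ∃ u, 0 < u a ∧ maxVec A u = α • u := by
    rintro a b hab ⟨u, hu, hu'⟩
    exact ⟨maxVec B u, (mul_pos hab hu).trans_le (le_maxVec B u a b),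
      maxVec_eigenvector_of_commute hcomm hu'⟩
  have key : ∀ i, ∃ u : n → ℝ≥0, 0 < u i ∧ maxVec A u = α • u := by
    intro i
    have hj' : ∃ u : n → ℝ≥0, 0 < u j ∧ maxVec A u = α • u := ⟨v, pos_iff_ne_zero.2 hj, hv'⟩
    by_cases hij : i = j
    · exact hij ▸ hj'
    · induction hB i j hij using Relation.TransGen.head_induction_on with
      | single h => exact step _ _ h hj'
      | head h _ ih =>
        rename_i a c _
        by_cases hc : c = j
        · exact step _ _ h (hc ▸ hj')
        · exact step _ _ h (ih hc)
  choose U hU hU' using key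
  let M : Matrix n n ℝ≥0 := fun k i => U i k
  have hM : maxMul A M = α • M := by
    funext k i
    exact congrFun (hU' i) k
  refine ⟨maxVec M 1, fun i => ?_, ?_⟩
  · exact (mul_pos (hU i) one_pos).trans_le (le_maxVec M 1 i i)
  · rw [maxVec_maxVec, hM, smul_maxVec]

/-- The eigenvalue of an eigenvector with full support bounds every other eigenvalue. -/
lemma eigenvalue_le_of_pos_eigenvector {n : Type*} [Fintype n] {A : Matrix n n ℝ≥0}
    {α β : ℝ≥0} {u w : n → ℝ≥0} (hu : ∀ i, 0 < u i) (hu' : maxVec A u = α • u)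
    (hw : w ≠ 0) (hw' : maxVec A w = β • w) : β ≤ α := by
  obtain ⟨j, hj⟩ := Function.ne_iff.1 hw
  have : Nonempty n := ⟨j⟩
  obtain ⟨i, hi⟩ := Finite.exists_max fun k => w k / u k
  have hpos : 0 < w i := by
    have h : 0 < w i / u i := (div_pos (pos_iff_ne_zero.2 hj) (hu j)).trans_le (hi j)
    exact pos_iff_ne_zero.2 fun h0 => by simp [h0] at h
  have hle : ∀ k, w k ≤ w i / u i * u k := fun k => (div_le_iff₀ (hu k)).1 (hi k)
  have hmain : β * w i ≤ α * w i := calc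
    β * w i = maxVec A w i := (congrFun hw' i).symm
    _ ≤ maxVec A ((w i / u i) • u) i :=
      (iSup_le_iff_of_finite _ _).2 fun k =>
        (mul_le_mul_right (hle k) (A i k)).trans (le_maxVec A ((w i / u i) • u) i k)
    _ = w i / u i * (α * u i) := by rw [maxVec_smul, hu']; rfl
    _ = α * w i := by rw [mul_left_comm, div_mul_cancel₀ _ (hu i).ne']
  exact le_of_mul_le_mul_right hmain hpos

theorem unique_eigenvalue_of_commuting_with_irreducible {n : Type*} [Fintype n]
    (A B : Matrix n n ℝ≥0) (hcomm : maxMul A B = maxMul B A)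
    (hB : MaxIrreducible B)
    (α β : ℝ≥0) (v w : n → ℝ≥0)
    (hv : v ≠ 0) (hv' : maxVec A v = α • v)
    (hw : w ≠ 0) (hw' : maxVec A w = β • w) :
    α = β := by
  obtain ⟨x, hx, hx'⟩ := exists_pos_eigenvector hcomm hB hv hv'
  obtain ⟨y, hy, hy'⟩ := exists_pos_eigenvector hcomm hB hw hw'
  exact le_antisymm (eigenvalue_le_of_pos_eigenvector hy hy' hv hv')
    (eigenvalue_le_of_pos_eigenvector hx hx' hw hw')
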